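/- For every α > 0, η ∈ [0, 2α] and p1 ∈ [1/2, 1), the integral ∫₁^∞ σ^(1−p1) · G(σ, α, η) dσ is finite and bounded above by M1(α) := ∫₁^∞ σ^(1/2) · (α²(σ−1)+4α²)(σ−1) / (σ²·(σ² + α²(σ−1)²)) dσ, which is a finite constant depending only on α. -/

import Mathlib

open Set MeasureTheory

lemma kernel_nonneg {σ α η : ℝ} (hσ : 1 < σ) (hα : 0 < α) (hη : 0 ≤ η) :
    0 ≤ (1/2 : ℝ) * (1 / (σ ^ 2 + η ^ 2) - 1 / (σ ^ 2 + (α * (σ - 1) + η) ^ 2)) := by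
  have ht : 0 ≤ α * (σ - 1) := mul_nonneg hα.le (by linarith)
  have h : 1 / (σ ^ 2 + (α * (σ - 1) + η) ^ 2) ≤ 1 / (σ ^ 2 + η ^ 2) := by
    gcongr
    linarith
  linarith

lemma kernel_le {σ α η : ℝ} (hσ : 1 < σ) (hα : 0 < α) (hη : 0 ≤ η) (hηα : η ≤ 2 * α) :
    (1/2 : ℝ) * (1 / (σ ^ 2 + η ^ 2) - 1 / (σ ^ 2 + (α * (σ - 1) + η) ^ 2)) ≤
      (α ^ 2 * (σ - 1) + 4 * α ^ 2) * (σ - 1) /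
        (σ ^ 2 * (σ ^ 2 + α ^ 2 * (σ - 1) ^ 2)) := by
  have hσ0 : 0 < σ := by linarith
  have ht : 0 < σ - 1 := by linarith
  have hαt : 0 ≤ α * (σ - 1) := by positivity
  have hprod : α * (σ - 1) * η ≤ α * (σ - 1) * (2 * α) :=
    mul_le_mul_of_nonneg_left hηα hαt
  calc (1/2 : ℝ) * (1 / (σ ^ 2 + η ^ 2) - 1 / (σ ^ 2 + (α * (σ - 1) + η) ^ 2))
      = (1/2 * (α ^ 2 * (σ - 1) ^ 2 + 2 * α * η * (σ - 1))) /
          ((σ ^ 2 + η ^ 2) * (σ ^ 2 + (α * (σ - 1) + η) ^ 2)) := by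
        field_simp
        ring
    _ ≤ _ := by
        gcongr ?_ / (?_ * ?_)
        · nlinarith [sq_nonneg (α * (σ - 1))]
        · nlinarith [sq_nonneg η]
        · nlinarith [mul_nonneg hαt hη, sq_nonneg η]

lemma majorant_le {σ : ℝ} (α : ℝ) (hσ : 1 < σ) :
    (α ^ 2 * (σ - 1) + 4 * α ^ 2) * (σ - 1) / (σ ^ 2 * (σ ^ 2 + α ^ 2 * (σ - 1) ^ 2)) ≤
      (1 + 4 * α ^ 2) / σ ^ 2 := by
  have hσ0 : 0 < σ := by linarith
  have h1 : σ - 1 ≤ σ ^ 2 := by nlinarith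
  have h2 : α ^ 2 * (σ - 1) ≤ α ^ 2 * σ ^ 2 := mul_le_mul_of_nonneg_left h1 (sq_nonneg α)
  rw [← div_div, div_right_comm]
  gcongr
  rw [div_le_iff₀ (by positivity)]
  nlinarith [sq_nonneg (α * (α * (σ - 1))), sq_nonneg σ]

lemma integrableOn_majorant (α : ℝ) :
    IntegrableOn (fun σ : ℝ => σ ^ ((1:ℝ)/2) *
        ((α ^ 2 * (σ - 1) + 4 * α ^ 2) * (σ - 1) /
          (σ ^ 2 * (σ ^ 2 + α ^ 2 * (σ - 1) ^ 2)))) (Set.Ioi 1) := by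
  have hint : IntegrableOn (fun σ : ℝ => (1 + 4 * α ^ 2) * σ ^ (-(3:ℝ)/2)) (Set.Ioi 1) :=
    (integrableOn_Ioi_rpow_of_lt (by norm_num) one_pos).const_mul _
  refine hint.mono' (Measurable.aestronglyMeasurable (by fun_prop)) ?_
  filter_upwards [ae_restrict_mem measurableSet_Ioi] with σ hσ
  have hσ1 : 1 < σ := hσ
  have hσ0 : 0 < σ := by linarith
  have ht : 0 ≤ σ - 1 := by linarith
  rw [Real.norm_of_nonneg (by positivity)]
  calc _ ≤ σ ^ ((1:ℝ)/2) * ((1 + 4 * α ^ 2) / σ ^ 2) := by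
        exact mul_le_mul_of_nonneg_left (majorant_le α hσ1) (by positivity)
    _ = (1 + 4 * α ^ 2) * (σ ^ ((1:ℝ)/2) / σ ^ (2:ℝ)) := by
        rw [Real.rpow_two]
        ring
    _ = _ := by
        rw [← Real.rpow_sub hσ0]
        norm_num

/-- Upper bound `M1(α)` for `∫₁^∞ σ^(1−p1)·G(σ,α,η) dσ`, uniform in
`η ∈ [0,2α]` and `p1 ∈ [1/2,1)`. -/
theorem stmt_4 (α η p1 : ℝ) (hα : 0 < α) (hη : η ∈ Set.Icc (0 : ℝ) (2 * α))
    (hp1 : p1 ∈ Set.Ico (1/2 : ℝ) 1) :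
    IntegrableOn (fun σ : ℝ => σ ^ (1 - p1) *
        ((1/2 : ℝ) * (1 / (σ ^ 2 + η ^ 2) - 1 / (σ ^ 2 + (α * (σ - 1) + η) ^ 2))))
      (Set.Ioi 1) ∧
    IntegrableOn (fun σ : ℝ => σ ^ ((1:ℝ)/2) *
        ((α ^ 2 * (σ - 1) + 4 * α ^ 2) * (σ - 1) /
          (σ ^ 2 * (σ ^ 2 + α ^ 2 * (σ - 1) ^ 2)))) (Set.Ioi 1) ∧
    (∫ σ in Set.Ioi (1 : ℝ), σ ^ (1 - p1) *
        ((1/2 : ℝ) * (1 / (σ ^ 2 + η ^ 2) - 1 / (σ ^ 2 + (α * (σ - 1) + η) ^ 2)))) ≤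
      ∫ σ in Set.Ioi (1 : ℝ), σ ^ ((1:ℝ)/2) *
        ((α ^ 2 * (σ - 1) + 4 * α ^ 2) * (σ - 1) /
          (σ ^ 2 * (σ ^ 2 + α ^ 2 * (σ - 1) ^ 2))) := by
  obtain ⟨hη0, hηα⟩ := hη
  obtain ⟨hp, -⟩ := hp1
  have hM := integrableOn_majorant α
  have hle : ∀ σ ∈ Set.Ioi (1 : ℝ), σ ^ (1 - p1) *
        ((1/2 : ℝ) * (1 / (σ ^ 2 + η ^ 2) - 1 / (σ ^ 2 + (α * (σ - 1) + η) ^ 2))) ≤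
      σ ^ ((1:ℝ)/2) * ((α ^ 2 * (σ - 1) + 4 * α ^ 2) * (σ - 1) /
          (σ ^ 2 * (σ ^ 2 + α ^ 2 * (σ - 1) ^ 2))) := by
    intro σ hσ
    have hσ1 : 1 < σ := hσ
    exact mul_le_mul (Real.rpow_le_rpow_of_exponent_le hσ1.le (by linarith))
      (kernel_le hσ1 hα hη0 hηα) (kernel_nonneg hσ1 hα hη0) (by positivity)
  have hG : IntegrableOn (fun σ : ℝ => σ ^ (1 - p1) *
        ((1/2 : ℝ) * (1 / (σ ^ 2 + η ^ 2) - 1 / (σ ^ 2 + (α * (σ - 1) + η) ^ 2))))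
      (Set.Ioi 1) := by
    refine hM.mono' (Measurable.aestronglyMeasurable (by fun_prop)) ?_
    filter_upwards [ae_restrict_mem measurableSet_Ioi] with σ hσ
    have hσ1 : 1 < σ := hσ
    rw [Real.norm_of_nonneg
      (mul_nonneg (Real.rpow_nonneg (by linarith) _) (kernel_nonneg hσ1 hα hη0))]
    exact hle σ hσ
  exact ⟨hG, hM, setIntegral_mono_on hG hM measurableSet_Ioi hle⟩
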